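/- Assume (A1) and (A2), let λ > 0 and N ≥ 1, and let μ̃_z^* be a λ-tilted Stage-I selection. Let x^{(1)}, …, x^{(N)}, x ∈ ℝ^{d_x} and i ∈ {1, …, N}, and set μ_X := (1/N)·Σ_{j=1}^N δ_{x^{(j)}} and μ' := (1/N)·Σ_{j≠i} δ_{x^{(j)}} + (1/N)·δ_x. Define the first variation δ₁U₁(μ_x, μ_z)(x₀) := ∫(∫Ψ_𝐚 dμ_x − ∫Ψ_𝐰 dμ_z)·Ψ_𝐚(x₀) dρ(𝐚,𝐰,y). Then for every x₀ ∈ ℝ^{d_x}: |δ₁U₁(μ_X, μ̃_z^*(μ_X))(x₀) − δ₁U₁(μ', μ̃_z^*(μ'))(x₀)| ≤ (1/N)·(2R² + √(2/σ₁)·R³). -/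

import Mathlib

open MeasureTheory ProbabilityTheory Real Filter
open scoped ENNReal Classical

noncomputable section

/-- `Euc d` is Euclidean space `ℝ^d`. -/
abbrev Euc (d : ℕ) : Type := EuclideanSpace ℝ (Fin d)

/-- `P₂(ℝ^d)`: Borel probability measures with finite second moment. -/
def IsP2 {d : ℕ} (μ : Measure (Euc d)) : Prop :=
  IsProbabilityMeasure μ ∧ Integrable (fun x => ‖x‖ ^ 2) μ

/-- Negative entropy of a probability measure, valued in `ℝ ∪ {+∞}` (as `EReal`):
the integral `∫ log(dμ/dLeb) dμ` if `μ` is absolutely continuous w.r.t. Lebesgue measure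
and that integral exists in `ℝ`, and `+∞` otherwise. -/
def Ent {d : ℕ} (μ : Measure (Euc d)) : EReal :=
  if μ ≪ (volume : Measure (Euc d)) ∧
      Integrable (fun x => Real.log (μ.rnDeriv volume x).toReal) μ then
    ((∫ x, Real.log (μ.rnDeriv volume x).toReal ∂μ : ℝ) : EReal)
  else ⊤

/-- Kullback–Leibler divergence `KL(ν, μ)`, valued in `ℝ ∪ {+∞}` (as `EReal`). -/
def KL {α : Type*} [MeasurableSpace α] (ν μ : Measure α) : EReal :=
  if ν ≪ μ ∧ Integrable (fun x => Real.log (ν.rnDeriv μ x).toReal) ν then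
    ((∫ x, Real.log (ν.rnDeriv μ x).toReal ∂ν : ℝ) : EReal)
  else ⊤

section Setting

variable {da dw dx dz : ℕ}

/-- Stage-I unregularized objective `U₁`. -/
def U1 (ρ : Measure (Euc da × Euc dw × ℝ)) (ΨA : Euc da → Euc dx → ℝ)
    (ΨW : Euc dw → Euc dz → ℝ) (μx : Measure (Euc dx)) (μz : Measure (Euc dz)) : ℝ :=
  (1 / 2) * ∫ p, ((∫ z, ΨW p.2.1 z ∂μz) - (∫ x, ΨA p.1 x ∂μx)) ^ 2 ∂ρ

/-- Stage-II unregularized objective `U₂`. -/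
def U2 (ρ : Measure (Euc da × Euc dw × ℝ)) (ΨW : Euc dw → Euc dz → ℝ)
    (μz : Measure (Euc dz)) : ℝ :=
  (1 / 2) * ∫ p, ((∫ z, ΨW p.2.1 z ∂μz) - p.2.2) ^ 2 ∂ρ

/-- `F₁ = U₁ + (ζ₁/2)·second moment of μ_z`. -/
def F1 (ρ : Measure (Euc da × Euc dw × ℝ)) (ΨA : Euc da → Euc dx → ℝ)
    (ΨW : Euc dw → Euc dz → ℝ) (ζ1 : ℝ) (μx : Measure (Euc dx)) (μz : Measure (Euc dz)) : ℝ :=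
  U1 ρ ΨA ΨW μx μz + (ζ1 / 2) * ∫ z, ‖z‖ ^ 2 ∂μz

/-- `F₂ = U₂ + (ζ₂/2)·second moment of μ_x`. -/
def F2 (ρ : Measure (Euc da × Euc dw × ℝ)) (ΨW : Euc dw → Euc dz → ℝ) (ζ2 : ℝ)
    (μx : Measure (Euc dx)) (μz : Measure (Euc dz)) : ℝ :=
  U2 ρ ΨW μz + (ζ2 / 2) * ∫ x, ‖x‖ ^ 2 ∂μx

/-- `𝓕₁ = F₁ + σ₁·Ent(μ_z)`, valued in `ℝ ∪ {+∞}`. -/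
def calF1 (ρ : Measure (Euc da × Euc dw × ℝ)) (ΨA : Euc da → Euc dx → ℝ)
    (ΨW : Euc dw → Euc dz → ℝ) (ζ1 σ1 : ℝ) (μx : Measure (Euc dx))
    (μz : Measure (Euc dz)) : EReal :=
  ((F1 ρ ΨA ΨW ζ1 μx μz : ℝ) : EReal) + (σ1 : EReal) * Ent μz

/-- `𝓕₂ = F₂ + σ₂·Ent(μ_x)`, valued in `ℝ ∪ {+∞}`. -/
def calF2 (ρ : Measure (Euc da × Euc dw × ℝ)) (ΨW : Euc dw → Euc dz → ℝ) (ζ2 σ2 : ℝ)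
    (μx : Measure (Euc dx)) (μz : Measure (Euc dz)) : EReal :=
  ((F2 ρ ΨW ζ2 μx μz : ℝ) : EReal) + (σ2 : EReal) * Ent μx

/-- Assumption (A1): bounded target, `|y| ≤ M` for `ρ`-a.e. `(𝐚, 𝐰, y)`. -/
def A1 (ρ : Measure (Euc da × Euc dw × ℝ)) (M : ℝ) : Prop :=
  ∀ᵐ p ∂ρ, |p.2.2| ≤ M

/-- Assumption (A2): jointly measurable, bounded and smooth networks with bounded gradients. -/
def A2 (ΨA : Euc da → Euc dx → ℝ) (ΨW : Euc dw → Euc dz → ℝ) (R : ℝ) : Prop :=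
  Measurable (Function.uncurry ΨA) ∧ Measurable (Function.uncurry ΨW) ∧
    (∀ a x, |ΨA a x| ≤ R) ∧ (∀ w z, |ΨW w z| ≤ R) ∧
    (∀ a, Differentiable ℝ (ΨA a)) ∧ (∀ a x, ‖fderiv ℝ (ΨA a) x‖ ≤ R) ∧
    (∀ w, Differentiable ℝ (ΨW w)) ∧ (∀ w z, ‖fderiv ℝ (ΨW w) z‖ ≤ R)

/-- A Stage-I selection: to each `μ_x ∈ P₂` it assigns a global minimizer of `𝓕₁(μ_x, ·)`
over `P₂(ℝ^{d_z})`, with finite value. -/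
def IsStageOneSel (ρ : Measure (Euc da × Euc dw × ℝ)) (ΨA : Euc da → Euc dx → ℝ)
    (ΨW : Euc dw → Euc dz → ℝ) (ζ1 σ1 : ℝ)
    (sel : Measure (Euc dx) → Measure (Euc dz)) : Prop :=
  ∀ μx, IsP2 μx →
    IsP2 (sel μx) ∧ calF1 ρ ΨA ΨW ζ1 σ1 μx (sel μx) ≠ ⊤ ∧
      calF1 ρ ΨA ΨW ζ1 σ1 μx (sel μx) ≠ ⊥ ∧
      ∀ ν, IsP2 ν → calF1 ρ ΨA ΨW ζ1 σ1 μx (sel μx) ≤ calF1 ρ ΨA ΨW ζ1 σ1 μx ν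

/-- The Lagrangian `𝓛_λ(μ_x, μ_z) = 𝓕₂(μ_x, μ_z) + λ(𝓕₁(μ_x, μ_z) − 𝓕₁(μ_x, μ_z^*(μ_x)))`. -/
def Lag (ρ : Measure (Euc da × Euc dw × ℝ)) (ΨA : Euc da → Euc dx → ℝ)
    (ΨW : Euc dw → Euc dz → ℝ) (ζ1 ζ2 σ1 σ2 : ℝ)
    (sel : Measure (Euc dx) → Measure (Euc dz)) (lam : ℝ)
    (μx : Measure (Euc dx)) (μz : Measure (Euc dz)) : EReal :=
  calF2 ρ ΨW ζ2 σ2 μx μz +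
    (lam : EReal) * (calF1 ρ ΨA ΨW ζ1 σ1 μx μz - calF1 ρ ΨA ΨW ζ1 σ1 μx (sel μx))

end Setting

section Tilt

variable {da dw dx dz : ℕ}

/-- The λ-tilted Stage-I objective `G_{μ_x}(ν) = U₂(ν) + λF₁(μ_x, ν) + λσ₁ Ent(ν)`. -/
def Gtilt (ρ : Measure (Euc da × Euc dw × ℝ)) (ΨA : Euc da → Euc dx → ℝ)
    (ΨW : Euc dw → Euc dz → ℝ) (ζ1 σ1 lam : ℝ) (μx : Measure (Euc dx))
    (ν : Measure (Euc dz)) : EReal :=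
  ((U2 ρ ΨW ν + lam * F1 ρ ΨA ΨW ζ1 μx ν : ℝ) : EReal) + ((lam * σ1 : ℝ) : EReal) * Ent ν

/-- A λ-tilted Stage-I selection: to each `μ_x ∈ P₂` it assigns a global minimizer of
`G_{μ_x}` over `P₂(ℝ^{d_z})`, with finite value. -/
def IsTiltedSel (ρ : Measure (Euc da × Euc dw × ℝ)) (ΨA : Euc da → Euc dx → ℝ)
    (ΨW : Euc dw → Euc dz → ℝ) (ζ1 σ1 lam : ℝ)
    (til : Measure (Euc dx) → Measure (Euc dz)) : Prop :=
  ∀ μx, IsP2 μx →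
    IsP2 (til μx) ∧ Gtilt ρ ΨA ΨW ζ1 σ1 lam μx (til μx) ≠ ⊤ ∧
      Gtilt ρ ΨA ΨW ζ1 σ1 lam μx (til μx) ≠ ⊥ ∧
      ∀ ν, IsP2 ν → Gtilt ρ ΨA ΨW ζ1 σ1 lam μx (til μx) ≤ Gtilt ρ ΨA ΨW ζ1 σ1 lam μx ν

end Tilt

section FirstVar

variable {da dw dx dz : ℕ}

/-- First variation of `U₁` in its first argument:
`δ₁U₁(μ_x, μ_z)(x₀) = ∫ (∫Ψ_𝐚 dμ_x − ∫Ψ_𝐰 dμ_z)·Ψ_𝐚(x₀) dρ`. -/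
def delta1U1 (ρ : Measure (Euc da × Euc dw × ℝ)) (ΨA : Euc da → Euc dx → ℝ)
    (ΨW : Euc dw → Euc dz → ℝ) (μx : Measure (Euc dx)) (μz : Measure (Euc dz))
    (x0 : Euc dx) : ℝ :=
  ∫ p, ((∫ x, ΨA p.1 x ∂μx) - (∫ z, ΨW p.2.1 z ∂μz)) * ΨA p.1 x0 ∂ρ

end FirstVar

lemma convexOn_mul_log_sub_sq {S : ℝ} (hS : 0 < S) :
    ConvexOn ℝ (Set.Icc 0 S) fun u : ℝ => u * Real.log u - u ^ 2 / (2 * S) := by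
  have hd : ∀ u ∈ Set.Ioo (0 : ℝ) S,
      HasDerivAt (fun u : ℝ => u * Real.log u - u ^ 2 / (2 * S))
        (Real.log u + 1 - u / S) u := by
    intro u hu
    have h1 := Real.hasDerivAt_mul_log hu.1.ne'
    have h2 := (hasDerivAt_pow 2 u).div_const (2 * S)
    refine (h1.sub h2).congr_deriv ?_
    push_cast
    field_simp
  refine MonotoneOn.convexOn_of_deriv (convex_Icc 0 S) ?_ ?_ ?_
  · exact (Real.continuous_mul_log.sub (by fun_prop)).continuousOn
  · rw [interior_Icc]
    exact fun u hu => (hd u hu).differentiableAt.differentiableWithinAt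
  · rw [interior_Icc]
    intro u hu v hv huv
    rw [(hd u hu).deriv, (hd v hv).deriv]
    have hu0 := hu.1
    have hv0 := hv.1
    have h1 : Real.log (u / v) ≤ u / v - 1 := Real.log_le_sub_one_of_pos (by positivity)
    rw [Real.log_div hu0.ne' hv0.ne'] at h1
    have h2 : (v - u) / S ≤ (v - u) / v :=
      div_le_div_of_nonneg_left (by linarith) hv0 hv.2.le
    have h3 : (v - u) / v = 1 - u / v := by field_simp
    have h4 : (v - u) / S = v / S - u / S := sub_div _ _ _
    linarith

lemma mul_log_convexCombo_le {p q t g k : ℝ} (hp : 0 ≤ p) (hq : 0 ≤ q) (ht0 : 0 ≤ t)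
    (ht1 : t ≤ 1) (hg : |g| ≤ 1) :
    ((1 - t) * p + t * q) * Real.log ((1 - t) * p + t * q) ≤
      (1 - t) * (p * Real.log p) + t * (q * Real.log q) -
        t * (1 - t) / 2 * (2 * k * (g * p - g * q) - k ^ 2 * (p + q)) := by
  rcases (add_nonneg hp hq).eq_or_lt with h0 | hS
  · have hp0 : p = 0 := by linarith
    have hq0 : q = 0 := by linarith
    simp [hp0, hq0]
  · have hc := (convexOn_mul_log_sub_sq hS).2 (x := p) ⟨hp, by linarith⟩ (y := q)
      ⟨hq, by linarith⟩ (sub_nonneg.2 ht1) ht0 (by ring)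
    simp only [smul_eq_mul] at hc
    have hquad : 2 * k * (g * p - g * q) - k ^ 2 * (p + q) ≤ (p - q) ^ 2 / (p + q) := by
      rw [le_div_iff₀ hS]
      have hg2 : g ^ 2 ≤ 1 := (sq_le_one_iff_abs_le_one g).2 hg
      nlinarith [sq_nonneg ((p - q) - k * g * (p + q)),
        mul_nonneg (sub_nonneg.2 hg2) (sq_nonneg (k * (p + q)))]
    have hmul := mul_le_mul_of_nonneg_left hquad
      (by have := mul_nonneg ht0 (sub_nonneg.2 ht1); linarith : 0 ≤ t * (1 - t) / 2)
    have hid : ((1 - t) * p + t * q) ^ 2 / (2 * (p + q)) -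
        (1 - t) * (p ^ 2 / (2 * (p + q))) - t * (q ^ 2 / (2 * (p + q))) =
        -(t * (1 - t) / 2 * ((p - q) ^ 2 / (p + q))) := by
      field_simp
      ring
    linarith

lemma mul_log_add_mul_log_le {a b : ℝ} (ha : 0 ≤ a) (hb : 0 ≤ b) :
    a * Real.log a + b * Real.log b ≤ (a + b) * Real.log (a + b) := by
  rcases ha.eq_or_lt with rfl | ha
  · simp
  rcases hb.eq_or_lt with rfl | hb
  · simp
  have h1 := mul_le_mul_of_nonneg_left
    (Real.log_le_log ha (by linarith : a ≤ a + b)) ha.le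
  have h2 := mul_le_mul_of_nonneg_left
    (Real.log_le_log hb (by linarith : b ≤ a + b)) hb.le
  linarith

/-- The convex combination `(1 - t) • μ + t • ν` of two measures. -/
def mixture {α : Type*} [MeasurableSpace α] (t : ℝ) (μ ν : Measure α) : Measure α :=
  ENNReal.ofReal (1 - t) • μ + ENNReal.ofReal t • ν

section Mixture

variable {α : Type*} [MeasurableSpace α] {t : ℝ} {μ ν : Measure α}

lemma isProbabilityMeasure_mixture [IsProbabilityMeasure μ] [IsProbabilityMeasure ν]
    (ht0 : 0 ≤ t) (ht1 : t ≤ 1) : IsProbabilityMeasure (mixture t μ ν) := by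
  constructor
  simp [mixture, ← ENNReal.ofReal_add (sub_nonneg.2 ht1) ht0]

lemma integrable_mixture {g : α → ℝ} (hμ : Integrable g μ) (hν : Integrable g ν) :
    Integrable g (mixture t μ ν) :=
  (hμ.smul_measure ENNReal.ofReal_ne_top).add_measure (hν.smul_measure ENNReal.ofReal_ne_top)

lemma integral_mixture (ht0 : 0 ≤ t) (ht1 : t ≤ 1) {g : α → ℝ} (hμ : Integrable g μ)
    (hν : Integrable g ν) :
    ∫ x, g x ∂(mixture t μ ν) = (1 - t) * ∫ x, g x ∂μ + t * ∫ x, g x ∂ν := by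
  rw [mixture, integral_add_measure (hμ.smul_measure ENNReal.ofReal_ne_top)
    (hν.smul_measure ENNReal.ofReal_ne_top), integral_smul_measure, integral_smul_measure,
    ENNReal.toReal_ofReal ht0, ENNReal.toReal_ofReal (sub_nonneg.2 ht1), smul_eq_mul, smul_eq_mul]

lemma mixture_absolutelyContinuous {m : Measure α} (hμ : μ ≪ m) (hν : ν ≪ m) :
    mixture t μ ν ≪ m := by
  intro s hs
  simp [mixture, hμ hs, hν hs]

lemma toReal_rnDeriv_mixture {m : Measure α} [SigmaFinite m] [IsFiniteMeasure μ]
    [IsFiniteMeasure ν] (ht0 : 0 ≤ t) (ht1 : t ≤ 1) :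
    ∀ᵐ x ∂m, ((mixture t μ ν).rnDeriv m x).toReal =
      (1 - t) * (μ.rnDeriv m x).toReal + t * (ν.rnDeriv m x).toReal := by
  have hfμ : IsFiniteMeasure (ENNReal.ofReal (1 - t) • μ) :=
    μ.smul_finite ENNReal.ofReal_ne_top
  have hfν : IsFiniteMeasure (ENNReal.ofReal t • ν) := ν.smul_finite ENNReal.ofReal_ne_top
  filter_upwards [Measure.rnDeriv_add (ENNReal.ofReal (1 - t) • μ) (ENNReal.ofReal t • ν) m,
    Measure.rnDeriv_smul_left_of_ne_top μ m (r := ENNReal.ofReal (1 - t)) ENNReal.ofReal_ne_top,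
    Measure.rnDeriv_smul_left_of_ne_top ν m (r := ENNReal.ofReal t) ENNReal.ofReal_ne_top,
    Measure.rnDeriv_lt_top μ m, Measure.rnDeriv_lt_top ν m] with x h1 h2 h3 h4 h5
  rw [mixture, h1, Pi.add_apply, h2, h3, Pi.smul_apply, Pi.smul_apply, smul_eq_mul, smul_eq_mul,
    ENNReal.toReal_add (ENNReal.mul_ne_top ENNReal.ofReal_ne_top h4.ne)
      (ENNReal.mul_ne_top ENNReal.ofReal_ne_top h5.ne),
    ENNReal.toReal_mul, ENNReal.toReal_mul, ENNReal.toReal_ofReal ht0,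
    ENNReal.toReal_ofReal (sub_nonneg.2 ht1)]

/-- Strong convexity of the negative entropy along mixtures, tested against a function bounded
by one. -/
lemma integral_log_rnDeriv_mixture_le {m : Measure α} [SigmaFinite m] [IsProbabilityMeasure μ]
    [IsProbabilityMeasure ν] (hμ : μ ≪ m) (hν : ν ≪ m)
    (hlμ : Integrable (fun x => Real.log (μ.rnDeriv m x).toReal) μ)
    (hlν : Integrable (fun x => Real.log (ν.rnDeriv m x).toReal) ν)
    (ht0 : 0 < t) (ht1 : t < 1) {g : α → ℝ} (hg : Measurable g) (hg1 : ∀ x, |g x| ≤ 1) :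
    Integrable (fun x => Real.log ((mixture t μ ν).rnDeriv m x).toReal) (mixture t μ ν) ∧
      ∫ x, Real.log ((mixture t μ ν).rnDeriv m x).toReal ∂(mixture t μ ν) ≤
        (1 - t) * (∫ x, Real.log (μ.rnDeriv m x).toReal ∂μ) +
          t * (∫ x, Real.log (ν.rnDeriv m x).toReal ∂ν) -
          t * (1 - t) / 4 * (∫ x, g x ∂μ - ∫ x, g x ∂ν) ^ 2 := by
  have hprob := isProbabilityMeasure_mixture (μ := μ) (ν := ν) ht0.le ht1.le
  have hac := mixture_absolutelyContinuous (t := t) hμ hν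
  set η := mixture t μ ν with hη
  have hgμ : Integrable g μ := .of_bound hg.aestronglyMeasurable 1 (.of_forall hg1)
  have hgν : Integrable g ν := .of_bound hg.aestronglyMeasurable 1 (.of_forall hg1)
  set p : α → ℝ := fun x => (μ.rnDeriv m x).toReal with hp
  set q : α → ℝ := fun x => (ν.rnDeriv m x).toReal with hq
  set r : α → ℝ := fun x => (η.rnDeriv m x).toReal with hr
  have hpm : Measurable p := (Measure.measurable_rnDeriv μ m).ennreal_toReal
  have hqm : Measurable q := (Measure.measurable_rnDeriv ν m).ennreal_toReal
  have hrm : Measurable r := (Measure.measurable_rnDeriv η m).ennreal_toReal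
  have hp0 : ∀ x, 0 ≤ p x := fun x => ENNReal.toReal_nonneg
  have hq0 : ∀ x, 0 ≤ q x := fun x => ENNReal.toReal_nonneg
  have hpi : Integrable p m := Measure.integrable_toReal_rnDeriv
  have hqi : Integrable q m := Measure.integrable_toReal_rnDeriv
  have hpl : Integrable (fun x => p x * Real.log (p x)) m := (integrable_rnDeriv_smul_iff hμ).2 hlμ
  have hql : Integrable (fun x => q x * Real.log (q x)) m := (integrable_rnDeriv_smul_iff hν).2 hlν
  have hgp : Integrable (fun x => g x * p x) m :=
    ((integrable_rnDeriv_smul_iff hμ).2 hgμ).congr (.of_forall fun x => by simp [hp, mul_comm])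
  have hgq : Integrable (fun x => g x * q x) m :=
    ((integrable_rnDeriv_smul_iff hν).2 hgν).congr (.of_forall fun x => by simp [hq, mul_comm])
  have hr' : ∀ᵐ x ∂m, r x = (1 - t) * p x + t * q x := toReal_rnDeriv_mixture ht0.le ht1.le
  set k : ℝ := (∫ x, g x ∂μ - ∫ x, g x ∂ν) / 2 with hk
  have hq1 : Integrable (fun x => (1 - t) * (p x * Real.log (p x)) + t * (q x * Real.log (q x))) m :=
    (hpl.const_mul _).add (hql.const_mul _)
  have hq2 : Integrable (fun x => 2 * k * (g x * p x - g x * q x)) m :=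
    (hgp.sub hgq).const_mul _
  have hq3 : Integrable (fun x => k ^ 2 * (p x + q x)) m := (hpi.add hqi).const_mul _
  have hq4 : Integrable (fun x => t * (1 - t) / 2 *
      (2 * k * (g x * p x - g x * q x) - k ^ 2 * (p x + q x))) m := (hq2.sub hq3).const_mul _
  have hupper : ∀ᵐ x ∂m, r x * Real.log (r x) ≤
      ((1 - t) * (p x * Real.log (p x)) + t * (q x * Real.log (q x))) - t * (1 - t) / 2 *
      (2 * k * (g x * p x - g x * q x) - k ^ 2 * (p x + q x)) := by
    filter_upwards [hr'] with x hx
    rw [hx]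
    exact mul_log_convexCombo_le (hp0 x) (hq0 x) ht0.le ht1.le (hg1 x)
  have hscale : ∀ s u : ℝ, 0 < s →
      s * u * Real.log (s * u) = s * Real.log s * u + s * (u * Real.log u) := by
    intro s u hs
    rcases eq_or_ne u 0 with rfl | hu
    · simp
    · rw [Real.log_mul hs.ne' hu]; ring
  have hlower : ∀ᵐ x ∂m,
      ((1 - t) * Real.log (1 - t) * p x + (1 - t) * (p x * Real.log (p x))) +
        (t * Real.log t * q x + t * (q x * Real.log (q x))) ≤ r x * Real.log (r x) := by
    filter_upwards [hr'] with x hx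
    rw [hx, ← hscale _ _ (sub_pos.2 ht1), ← hscale _ _ ht0]
    exact mul_log_add_mul_log_le (mul_nonneg (sub_pos.2 ht1).le (hp0 x))
      (mul_nonneg ht0.le (hq0 x))
  have hrl : Integrable (fun x => r x * Real.log (r x)) m :=
    integrable_of_le_of_le (hrm.mul hrm.log).aestronglyMeasurable hlower hupper
      (((hpi.const_mul _).add (hpl.const_mul _)).add ((hqi.const_mul _).add (hql.const_mul _)))
      (hq1.sub hq4)
  refine ⟨(integrable_rnDeriv_smul_iff hac).1 hrl, ?_⟩
  have hle := integral_mono_ae hrl (hq1.sub hq4) hupper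
  have e1 : ∫ x, r x * Real.log (r x) ∂m = ∫ x, Real.log (r x) ∂η := integral_rnDeriv_smul hac
  have e2 : ∫ x, p x * Real.log (p x) ∂m = ∫ x, Real.log (p x) ∂μ := integral_rnDeriv_smul hμ
  have e3 : ∫ x, q x * Real.log (q x) ∂m = ∫ x, Real.log (q x) ∂ν := integral_rnDeriv_smul hν
  have e4 : ∫ x, g x * p x ∂m = ∫ x, g x ∂μ := by
    rw [← integral_rnDeriv_smul hμ]; simp [hp, mul_comm]
  have e5 : ∫ x, g x * q x ∂m = ∫ x, g x ∂ν := by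
    rw [← integral_rnDeriv_smul hν]; simp [hq, mul_comm]
  have e6 : ∫ x, p x ∂m = 1 := by
    rw [hp, Measure.integral_toReal_rnDeriv hμ]; simp
  have e7 : ∫ x, q x ∂m = 1 := by
    rw [hq, Measure.integral_toReal_rnDeriv hν]; simp
  simp only [Pi.sub_apply] at hle
  rw [integral_sub hq1 hq4, integral_add (hpl.const_mul _) (hql.const_mul _),
    integral_const_mul, integral_const_mul, integral_const_mul, integral_sub hq2 hq3,
    integral_const_mul, integral_const_mul, integral_sub hgp hgq, integral_add hpi hqi,
    e1, e2, e3, e4, e5, e6, e7] at hle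
  refine hle.trans (le_of_eq ?_)
  rw [hk]
  ring

end Mixture

section Objective

variable {da dw dx dz : ℕ} {R M ζ1 σ1 lam t : ℝ} {ρ : Measure (Euc da × Euc dw × ℝ)}
  {ΨA : Euc da → Euc dx → ℝ} {ΨW : Euc dw → Euc dz → ℝ}
  {μx μx' : Measure (Euc dx)} {ν ν' : Measure (Euc dz)}

lemma ent_ne_top_of_Gtilt_ne_top (hlam : 0 < lam) (hσ1 : 0 < σ1)
    (h : Gtilt ρ ΨA ΨW ζ1 σ1 lam μx ν ≠ ⊤) : Ent ν ≠ ⊤ := by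
  intro he
  apply h
  rw [Gtilt, he, EReal.coe_mul_top_of_pos (mul_pos hlam hσ1), EReal.coe_add_top]

lemma Ent_of_ac_of_integrable {d : ℕ} {μ : Measure (Euc d)} (hμ : μ ≪ volume)
    (hl : Integrable (fun x => Real.log (μ.rnDeriv volume x).toReal) μ) :
    Ent μ = ((∫ x, Real.log (μ.rnDeriv volume x).toReal ∂μ : ℝ) : EReal) :=
  if_pos ⟨hμ, hl⟩

lemma ac_and_integrable_of_Ent_ne_top {d : ℕ} {μ : Measure (Euc d)} (h : Ent μ ≠ ⊤) :
    μ ≪ volume ∧ Integrable (fun x => Real.log (μ.rnDeriv volume x).toReal) μ := by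
  by_contra hc
  exact h (if_neg hc)

lemma Gtilt_of_ac_of_integrable (hν : ν ≪ volume)
    (hl : Integrable (fun x => Real.log (ν.rnDeriv volume x).toReal) ν) :
    Gtilt ρ ΨA ΨW ζ1 σ1 lam μx ν =
      ((U2 ρ ΨW ν + lam * F1 ρ ΨA ΨW ζ1 μx ν +
        lam * σ1 * ∫ x, Real.log (ν.rnDeriv volume x).toReal ∂ν : ℝ) : EReal) := by
  rw [Gtilt, Ent_of_ac_of_integrable hν hl]
  push_cast
  rfl

lemma isP2_mixture {d : ℕ} {μ μ' : Measure (Euc d)} (hμ : IsP2 μ) (hμ' : IsP2 μ')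
    (ht0 : 0 ≤ t) (ht1 : t ≤ 1) : IsP2 (mixture t μ μ') :=
  have := hμ.1
  have := hμ'.1
  ⟨isProbabilityMeasure_mixture ht0 ht1, integrable_mixture hμ.2 hμ'.2⟩

lemma A2.integrable_left (h : A2 ΨA ΨW R) (a : Euc da) (μ : Measure (Euc dx))
    [IsFiniteMeasure μ] : Integrable (ΨA a) μ :=
  .of_bound (h.1.comp measurable_prodMk_left).aestronglyMeasurable R (.of_forall (h.2.2.1 a))

lemma A2.integrable_right (h : A2 ΨA ΨW R) (w : Euc dw) (μ : Measure (Euc dz))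
    [IsFiniteMeasure μ] : Integrable (ΨW w) μ :=
  .of_bound (h.2.1.comp measurable_prodMk_left).aestronglyMeasurable R (.of_forall (h.2.2.2.1 w))

lemma A2.memLp_left (h : A2 ΨA ΨW R) [IsFiniteMeasure ρ] (μ : Measure (Euc dx))
    [IsProbabilityMeasure μ] : MemLp (fun p => ∫ x, ΨA p.1 x ∂μ) 2 ρ := by
  refine MemLp.of_bound ?_ R (.of_forall fun p => ?_)
  · exact (StronglyMeasurable.integral_prod_right (ν := μ)
      h.1.stronglyMeasurable |>.comp_measurable measurable_fst).aestronglyMeasurable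
  · simpa using norm_integral_le_of_norm_le_const (μ := μ) (f := ΨA p.1) (C := R)
      (.of_forall (h.2.2.1 p.1))

lemma A2.memLp_right (h : A2 ΨA ΨW R) [IsFiniteMeasure ρ] (μ : Measure (Euc dz))
    [IsProbabilityMeasure μ] : MemLp (fun p => ∫ z, ΨW p.2.1 z ∂μ) 2 ρ := by
  refine MemLp.of_bound ?_ R (.of_forall fun p => ?_)
  · exact (StronglyMeasurable.integral_prod_right (ν := μ)
      h.2.1.stronglyMeasurable |>.comp_measurable
        (measurable_fst.comp measurable_snd)).aestronglyMeasurable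
  · simpa using norm_integral_le_of_norm_le_const (μ := μ) (f := ΨW p.2.1) (C := R)
      (.of_forall (h.2.2.2.1 p.2.1))

lemma A1.memLp (h : A1 ρ M) [IsFiniteMeasure ρ] : MemLp (fun p => p.2.2) 2 ρ :=
  MemLp.of_bound (measurable_snd.comp measurable_snd).aestronglyMeasurable M h

lemma integral_sq_convexCombo_sub {α : Type*} [MeasurableSpace α] {τ : Measure α}
    {f g c : α → ℝ} (hf : MemLp f 2 τ) (hg : MemLp g 2 τ) (hc : MemLp c 2 τ) :
    ∫ x, ((1 - t) * f x + t * g x - c x) ^ 2 ∂τ =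
      (1 - t) * ∫ x, (f x - c x) ^ 2 ∂τ + t * ∫ x, (g x - c x) ^ 2 ∂τ -
        t * (1 - t) * ∫ x, (f x - g x) ^ 2 ∂τ := by
  have h1 : Integrable (fun x => (f x - c x) ^ 2) τ := (hf.sub hc).integrable_sq
  have h2 : Integrable (fun x => (g x - c x) ^ 2) τ := (hg.sub hc).integrable_sq
  have h3 : Integrable (fun x => (f x - g x) ^ 2) τ := (hf.sub hg).integrable_sq
  rw [← integral_const_mul, ← integral_const_mul, ← integral_const_mul,
    ← integral_add (h1.const_mul _) (h2.const_mul _),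
    ← integral_sub (f := fun x => (1 - t) * (f x - c x) ^ 2 + t * (g x - c x) ^ 2)
      ((h1.const_mul _).add (h2.const_mul _)) (h3.const_mul _)]
  congr 1 with x
  ring

/-- The smooth part of the tilted objective is quadratic along mixtures. -/
lemma U2_add_F1_mixture [IsFiniteMeasure ρ] (hA1 : A1 ρ M) (hA2 : A2 ΨA ΨW R)
    [IsProbabilityMeasure μx] (hν : IsP2 ν) (hν' : IsP2 ν') (ht0 : 0 ≤ t) (ht1 : t ≤ 1) :
    U2 ρ ΨW (mixture t ν ν') + lam * F1 ρ ΨA ΨW ζ1 μx (mixture t ν ν') =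
      (1 - t) * (U2 ρ ΨW ν + lam * F1 ρ ΨA ΨW ζ1 μx ν) +
        t * (U2 ρ ΨW ν' + lam * F1 ρ ΨA ΨW ζ1 μx ν') -
        t * (1 - t) * ((1 + lam) / 2 *
          ∫ p, (∫ z, ΨW p.2.1 z ∂ν - ∫ z, ΨW p.2.1 z ∂ν') ^ 2 ∂ρ) := by
  have := hν.1
  have := hν'.1
  have hmix : ∀ w, ∫ z, ΨW w z ∂(mixture t ν ν') =
      (1 - t) * ∫ z, ΨW w z ∂ν + t * ∫ z, ΨW w z ∂ν' := fun w =>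
    integral_mixture ht0 ht1 (hA2.integrable_right w ν) (hA2.integrable_right w ν')
  simp only [U2, F1, U1, hmix]
  rw [integral_mixture ht0 ht1 hν.2 hν'.2,
    integral_sq_convexCombo_sub (hA2.memLp_right ν) (hA2.memLp_right ν') hA1.memLp,
    integral_sq_convexCombo_sub (hA2.memLp_right ν) (hA2.memLp_right ν') (hA2.memLp_left μx)]
  ring

/-- Quadratic growth of the tilted objective away from its minimizer. -/
lemma objective_add_quadratic_le [IsFiniteMeasure ρ] (hR : 0 < R) (hlam : 0 < lam)
    (hσ1 : 0 < σ1) (hA1 : A1 ρ M) (hA2 : A2 ΨA ΨW R) [IsProbabilityMeasure μx]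
    (hν : IsP2 ν) (hν' : IsP2 ν') (he : Ent ν ≠ ⊤) (he' : Ent ν' ≠ ⊤)
    (hmin : ∀ η, IsP2 η → Gtilt ρ ΨA ΨW ζ1 σ1 lam μx ν ≤ Gtilt ρ ΨA ΨW ζ1 σ1 lam μx η)
    (w : Euc dw) :
    U2 ρ ΨW ν + lam * F1 ρ ΨA ΨW ζ1 μx ν +
        lam * σ1 * (∫ x, Real.log (ν.rnDeriv volume x).toReal ∂ν) +
        ((1 + lam) / 2 * (∫ p, (∫ z, ΨW p.2.1 z ∂ν - ∫ z, ΨW p.2.1 z ∂ν') ^ 2 ∂ρ) +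
          lam * σ1 / (4 * R ^ 2) * (∫ z, ΨW w z ∂ν - ∫ z, ΨW w z ∂ν') ^ 2) ≤
      U2 ρ ΨW ν' + lam * F1 ρ ΨA ΨW ζ1 μx ν' +
        lam * σ1 * ∫ x, Real.log (ν'.rnDeriv volume x).toReal ∂ν' := by
  have := hν.1
  have := hν'.1
  obtain ⟨hac, hl⟩ := ac_and_integrable_of_Ent_ne_top he
  obtain ⟨hac', hl'⟩ := ac_and_integrable_of_Ent_ne_top he'
  have hg : Measurable fun z => ΨW w z / R := (hA2.2.1.comp measurable_prodMk_left).div_const R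
  have hg1 : ∀ z, |ΨW w z / R| ≤ 1 := fun z => by
    rw [abs_div, abs_of_pos hR, div_le_one hR]
    exact hA2.2.2.2.1 w z
  set J := ∫ p, (∫ z, ΨW p.2.1 z ∂ν - ∫ z, ΨW p.2.1 z ∂ν') ^ 2 ∂ρ
  set D := ∫ z, ΨW w z ∂ν - ∫ z, ΨW w z ∂ν' with hD
  set Q := (1 + lam) / 2 * J + lam * σ1 / (4 * R ^ 2) * D ^ 2 with hQ
  set V := U2 ρ ΨW ν + lam * F1 ρ ΨA ΨW ζ1 μx ν with hV
  set V' := U2 ρ ΨW ν' + lam * F1 ρ ΨA ΨW ζ1 μx ν' with hV'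
  set e := ∫ x, Real.log (ν.rnDeriv volume x).toReal ∂ν
  set e' := ∫ x, Real.log (ν'.rnDeriv volume x).toReal ∂ν'
  have hstep : ∀ t : ℝ, 0 < t → t < 1 → V + lam * σ1 * e + (1 - t) * Q ≤ V' + lam * σ1 * e' := by
    intro t ht0 ht1
    have hac_t := mixture_absolutelyContinuous (t := t) hac hac'
    obtain ⟨hlt, hle⟩ := integral_log_rnDeriv_mixture_le hac hac' hl hl' ht0 ht1 hg hg1
    have hm := hmin _ (isP2_mixture hν hν' ht0.le ht1.le)
    rw [Gtilt_of_ac_of_integrable hac hl, Gtilt_of_ac_of_integrable hac_t hlt,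
      EReal.coe_le_coe_iff, U2_add_F1_mixture hA1 hA2 hν hν' ht0.le ht1.le] at hm
    rw [integral_div, integral_div, ← sub_div, div_pow] at hle
    have hle2 := mul_le_mul_of_nonneg_left hle (mul_pos hlam hσ1).le
    have hfin : t * (V + lam * σ1 * e + (1 - t) * Q) ≤ t * (V' + lam * σ1 * e') := by
      have hid : lam * σ1 * (t * (1 - t) / 4 * (D ^ 2 / R ^ 2)) =
          t * (1 - t) * (lam * σ1 / (4 * R ^ 2) * D ^ 2) := by
        field_simp
      rw [mul_sub, hid] at hle2
      rw [hQ]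
      linarith
    exact le_of_mul_le_mul_left hfin ht0
  have hlim : Tendsto (fun t : ℝ => V + lam * σ1 * e + (1 - t) * Q) (nhdsWithin 0 (Set.Ioi 0))
      (nhds (V + lam * σ1 * e + Q)) := by
    have hcont : Continuous fun t : ℝ => V + lam * σ1 * e + (1 - t) * Q := by fun_prop
    simpa using (hcont.tendsto 0).mono_left nhdsWithin_le_nhds
  refine le_of_tendsto hlim ?_
  filter_upwards [Ioo_mem_nhdsGT (zero_lt_one' ℝ)] with t ht using hstep t ht.1 ht.2

end Objective

section LeaveOneOut

variable {da dw dx dz : ℕ} {R M ζ1 σ1 lam : ℝ} {ρ : Measure (Euc da × Euc dw × ℝ)}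
  {ΨA : Euc da → Euc dx → ℝ} {ΨW : Euc dw → Euc dz → ℝ}
  {til : Measure (Euc dx) → Measure (Euc dz)} {μx μx' : Measure (Euc dx)}

lemma sq_integral_abs_le_integral_sq {α : Type*} [MeasurableSpace α] {τ : Measure α}
    [IsProbabilityMeasure τ] {f : α → ℝ} (hf : MemLp f 2 τ) :
    (∫ x, |f x| ∂τ) ^ 2 ≤ ∫ x, f x ^ 2 ∂τ := by
  have h1 : Integrable (fun x => |f x|) τ := (hf.integrable one_le_two).abs
  have h2 : Integrable (fun x => f x ^ 2) τ := hf.integrable_sq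
  set m := ∫ x, |f x| ∂τ
  have h : ∫ x, (2 * m * |f x| - m ^ 2) ∂τ ≤ ∫ x, f x ^ 2 ∂τ :=
    integral_mono ((h1.const_mul _).sub (integrable_const _)) h2 fun x => by
      simp only
      nlinarith [sq_nonneg (|f x| - m), sq_abs (f x)]
  rw [integral_sub (h1.const_mul _) (integrable_const _), integral_const_mul] at h
  simp only [integral_const, probReal_univ, one_smul] at h
  linarith

/-- Stability of the tilted selection under a perturbation of the first argument. -/
lemma tiltedSel_l1_stability [IsProbabilityMeasure ρ] (hR : 0 < R) (hlam : 0 < lam)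
    (hσ1 : 0 < σ1) (hA1 : A1 ρ M) (hA2 : A2 ΨA ΨW R)
    (htil : IsTiltedSel ρ ΨA ΨW ζ1 σ1 lam til) (hμ : IsP2 μx) (hμ' : IsP2 μx') {c : ℝ}
    (hc : ∀ a, |∫ x, ΨA a x ∂μx - ∫ x, ΨA a x ∂μx'| ≤ c) :
    (1 + σ1 / (2 * R ^ 2)) *
      (∫ p, |∫ z, ΨW p.2.1 z ∂(til μx) - ∫ z, ΨW p.2.1 z ∂(til μx')| ∂ρ) ≤ c := by
  obtain ⟨hν, htop, -, hmin⟩ := htil μx hμ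
  obtain ⟨hν', htop', -, hmin'⟩ := htil μx' hμ'
  have he := ent_ne_top_of_Gtilt_ne_top hlam hσ1 htop
  have he' := ent_ne_top_of_Gtilt_ne_top hlam hσ1 htop'
  have := hμ.1
  have := hμ'.1
  have := hν.1
  have := hν'.1
  have hA := hA2.memLp_left (ρ := ρ) μx
  have hA' := hA2.memLp_left (ρ := ρ) μx'
  have hB := hA2.memLp_right (ρ := ρ) (til μx)
  have hB' := hA2.memLp_right (ρ := ρ) (til μx')
  have hf : MemLp (fun p => ∫ z, ΨW p.2.1 z ∂(til μx) - ∫ z, ΨW p.2.1 z ∂(til μx')) 2 ρ :=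
    hB.sub hB'
  have hfi : Integrable
      (fun p => |∫ z, ΨW p.2.1 z ∂(til μx) - ∫ z, ΨW p.2.1 z ∂(til μx')|) ρ :=
    (hf.integrable one_le_two).abs
  have hf2 : Integrable
      (fun p => (∫ z, ΨW p.2.1 z ∂(til μx) - ∫ z, ΨW p.2.1 z ∂(til μx')) ^ 2) ρ :=
    hf.integrable_sq
  have hJ := sq_integral_abs_le_integral_sq hf
  have hcross : U1 ρ ΨA ΨW μx (til μx') - U1 ρ ΨA ΨW μx (til μx) +
      (U1 ρ ΨA ΨW μx' (til μx) - U1 ρ ΨA ΨW μx' (til μx')) ≤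
      c * ∫ p, |∫ z, ΨW p.2.1 z ∂(til μx) - ∫ z, ΨW p.2.1 z ∂(til μx')| ∂ρ := by
    have i1 : Integrable (fun p => (∫ z, ΨW p.2.1 z ∂(til μx') - ∫ x, ΨA p.1 x ∂μx) ^ 2) ρ :=
      (hB'.sub hA).integrable_sq
    have i2 : Integrable (fun p => (∫ z, ΨW p.2.1 z ∂(til μx) - ∫ x, ΨA p.1 x ∂μx) ^ 2) ρ :=
      (hB.sub hA).integrable_sq
    have i3 : Integrable (fun p => (∫ z, ΨW p.2.1 z ∂(til μx) - ∫ x, ΨA p.1 x ∂μx') ^ 2) ρ :=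
      (hB.sub hA').integrable_sq
    have i4 : Integrable (fun p => (∫ z, ΨW p.2.1 z ∂(til μx') - ∫ x, ΨA p.1 x ∂μx') ^ 2) ρ :=
      (hB'.sub hA').integrable_sq
    simp only [U1]
    rw [← mul_sub, ← mul_sub, ← mul_add, ← integral_sub' i1 i2, ← integral_sub' i3 i4,
      ← integral_add' (i1.sub i2) (i3.sub i4), ← integral_const_mul, ← integral_const_mul]
    refine integral_mono (((i1.sub i2).add (i3.sub i4)).const_mul _) (hfi.const_mul _) fun p => ?_
    have habs := abs_mul (∫ x, ΨA p.1 x ∂μx - ∫ x, ΨA p.1 x ∂μx')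
      (∫ z, ΨW p.2.1 z ∂(til μx) - ∫ z, ΨW p.2.1 z ∂(til μx'))
    have hle := mul_le_mul_of_nonneg_right (hc p.1)
      (abs_nonneg (∫ z, ΨW p.2.1 z ∂(til μx) - ∫ z, ΨW p.2.1 z ∂(til μx')))
    refine le_trans (le_of_eq ?_) ((le_abs_self _).trans (habs.le.trans hle))
    simp only [Pi.add_apply, Pi.sub_apply]
    ring
  have hpoint : ∀ w, (1 + lam) * (∫ p, (∫ z, ΨW p.2.1 z ∂(til μx) -
        ∫ z, ΨW p.2.1 z ∂(til μx')) ^ 2 ∂ρ) +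
      lam * σ1 / (2 * R ^ 2) * (∫ z, ΨW w z ∂(til μx) - ∫ z, ΨW w z ∂(til μx')) ^ 2 ≤
      lam * (c * ∫ p, |∫ z, ΨW p.2.1 z ∂(til μx) - ∫ z, ΨW p.2.1 z ∂(til μx')| ∂ρ) := by
    intro w
    have h1 := objective_add_quadratic_le hR hlam hσ1 hA1 hA2 hν hν' he he' hmin w
    have h2 := objective_add_quadratic_le hR hlam hσ1 hA1 hA2 hν' hν he' he hmin' w
    simp only [sub_sq_comm (∫ z, ΨW _ z ∂(til μx')) (∫ z, ΨW _ z ∂(til μx))] at h2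
    have h3 := mul_le_mul_of_nonneg_left hcross hlam.le
    have h4 : lam * σ1 / (2 * R ^ 2) = 2 * (lam * σ1 / (4 * R ^ 2)) := by field_simp; norm_num
    rw [h4]
    simp only [F1] at h1 h2
    linarith
  have hint := integral_mono (μ := ρ)
    ((integrable_const _).add (hf2.const_mul (lam * σ1 / (2 * R ^ 2))))
    (integrable_const _) fun p => hpoint p.2.1
  simp only [Pi.add_apply] at hint
  rw [integral_add (integrable_const _) (hf2.const_mul _)] at hint
  simp only [integral_const_mul, integral_const, probReal_univ, one_smul] at hint
  set m := ∫ p, |∫ z, ΨW p.2.1 z ∂(til μx) - ∫ z, ΨW p.2.1 z ∂(til μx')| ∂ρ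
  set J := ∫ p, (∫ z, ΨW p.2.1 z ∂(til μx) - ∫ z, ΨW p.2.1 z ∂(til μx')) ^ 2 ∂ρ
  have hm0 : 0 ≤ m := integral_nonneg fun p => abs_nonneg _
  have hJ0 : 0 ≤ J := (sq_nonneg m).trans hJ
  rcases hm0.eq_or_lt with h0 | hm
  · rw [← h0, mul_zero]
    exact (abs_nonneg _).trans (hc 0)
  have hs : 0 < σ1 / (2 * R ^ 2) := by positivity
  have hJle : (1 + σ1 / (2 * R ^ 2)) * J ≤ c * m := by
    refine le_of_mul_le_mul_left ?_ hlam
    have : lam * σ1 / (2 * R ^ 2) = lam * (σ1 / (2 * R ^ 2)) := mul_div_assoc _ _ _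
    rw [this] at hint
    linarith
  have hmul := mul_le_mul_of_nonneg_left hJ (by linarith : 0 ≤ 1 + σ1 / (2 * R ^ 2))
  refine le_of_mul_le_mul_right ?_ hm
  linarith

lemma delta1U1_sub_le [IsProbabilityMeasure ρ] (hR : 0 < R) (hlam : 0 < lam)
    (hσ1 : 0 < σ1) (hA1 : A1 ρ M) (hA2 : A2 ΨA ΨW R)
    (htil : IsTiltedSel ρ ΨA ΨW ζ1 σ1 lam til) (hμ : IsP2 μx) (hμ' : IsP2 μx') {c : ℝ}
    (hc : ∀ a, |∫ x, ΨA a x ∂μx - ∫ x, ΨA a x ∂μx'| ≤ c) (x0 : Euc dx) :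
    |delta1U1 ρ ΨA ΨW μx (til μx) x0 - delta1U1 ρ ΨA ΨW μx' (til μx') x0| ≤
      c * (R + √(2 / σ1) * R ^ 2 / 2) := by
  have hstab := tiltedSel_l1_stability hR hlam hσ1 hA1 hA2 htil hμ hμ' hc
  have := hμ.1
  have := hμ'.1
  have := (htil μx hμ).1.1
  have := (htil μx' hμ').1.1
  have hA := hA2.memLp_left (ρ := ρ) μx
  have hA' := hA2.memLp_left (ρ := ρ) μx'
  have hB := hA2.memLp_right (ρ := ρ) (til μx)
  have hB' := hA2.memLp_right (ρ := ρ) (til μx')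
  have hfi : Integrable
      (fun p => |∫ z, ΨW p.2.1 z ∂(til μx) - ∫ z, ΨW p.2.1 z ∂(til μx')|) ρ :=
    ((hB.sub hB').integrable one_le_two).abs
  have hx0 : MemLp (fun p : Euc da × Euc dw × ℝ => ΨA p.1 x0) 2 ρ := by
    simpa using hA2.memLp_left (ρ := ρ) (Measure.dirac x0)
  set m := ∫ p, |∫ z, ΨW p.2.1 z ∂(til μx) - ∫ z, ΨW p.2.1 z ∂(til μx')| ∂ρ with hm
  have hm0 : 0 ≤ m := integral_nonneg fun p => abs_nonneg _
  have hbound : |delta1U1 ρ ΨA ΨW μx (til μx) x0 - delta1U1 ρ ΨA ΨW μx' (til μx') x0| ≤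
      (c + m) * R := by
    have i1 : Integrable (fun p =>
        (∫ x, ΨA p.1 x ∂μx - ∫ z, ΨW p.2.1 z ∂(til μx)) * ΨA p.1 x0) ρ :=
      (hA.sub hB).integrable_mul hx0
    have i2 : Integrable (fun p =>
        (∫ x, ΨA p.1 x ∂μx' - ∫ z, ΨW p.2.1 z ∂(til μx')) * ΨA p.1 x0) ρ :=
      (hA'.sub hB').integrable_mul hx0
    have hrhs : (c + m) * R = ∫ p, (c + |∫ z, ΨW p.2.1 z ∂(til μx) -
        ∫ z, ΨW p.2.1 z ∂(til μx')|) * R ∂ρ := by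
      rw [integral_mul_const, integral_add (integrable_const _) hfi]
      simp [hm]
    rw [delta1U1, delta1U1, ← integral_sub i1 i2, hrhs]
    refine (abs_integral_le_integral_abs).trans
      (integral_mono (i1.sub i2).abs (((integrable_const c).add hfi).mul_const R) fun p => ?_)
    simp only
    rw [← sub_mul, abs_mul]
    refine mul_le_mul ?_ (hA2.2.2.1 _ _) (abs_nonneg _)
      (add_nonneg ((abs_nonneg _).trans (hc 0)) (abs_nonneg _))
    rw [sub_sub_sub_comm]
    exact (abs_sub _ _).trans (add_le_add_left (hc p.1) _)
  set v := √(2 / σ1) with hv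
  have hv0 : 0 < v := Real.sqrt_pos.2 (by positivity)
  have hv2 : v ^ 2 * σ1 = 2 := by
    rw [hv, Real.sq_sqrt (by positivity)]
    field_simp
  have hs : σ1 / (2 * R ^ 2) = 1 / (R * v) ^ 2 := by
    field_simp
    linarith
  rw [hs] at hstab
  have hu : 0 < R * v := by positivity
  have hmc : m ≤ c * (R * v) / 2 := by
    have h1 : 2 * m ≤ (1 + 1 / (R * v) ^ 2) * m * (R * v) := by
      have h2 : 2 ≤ (1 + 1 / (R * v) ^ 2) * (R * v) := by
        have h3 : (1 + 1 / (R * v) ^ 2) * (R * v) = ((R * v) ^ 2 + 1) / (R * v) := by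
          field_simp
        rw [h3, le_div_iff₀ hu]
        nlinarith [sq_nonneg (R * v - 1)]
      nlinarith [mul_le_mul_of_nonneg_right h2 hm0]
    have h4 := mul_le_mul_of_nonneg_right hstab hu.le
    linarith
  refine hbound.trans ?_
  nlinarith [mul_le_mul_of_nonneg_right hmc hR.le]

variable {N : ℕ}

lemma isP2_empirical {d : ℕ} {ι : Type*} (s : Finset ι) (y : ι → Euc d) (hs : s.Nonempty) :
    IsP2 ((s.card : ℝ≥0∞)⁻¹ • ∑ j ∈ s, Measure.dirac (y j)) := by
  have hcard : (s.card : ℝ≥0∞) ≠ 0 := by simpa using hs.ne_empty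
  refine ⟨⟨?_⟩, ?_⟩
  · simp [ENNReal.inv_mul_cancel hcard (ENNReal.natCast_ne_top _)]
  · refine Integrable.smul_measure ?_ (ENNReal.inv_ne_top.2 hcard)
    exact integrable_finsetSum_measure.2 fun j _ => integrable_dirac (by simp)

lemma sum_erase_dirac_add {d : ℕ} (y : Fin N → Euc d) (x : Euc d) (i : Fin N) :
    (∑ j ∈ Finset.univ.erase i, Measure.dirac (y j)) + Measure.dirac x =
      ∑ j : Fin N, Measure.dirac (Function.update y i x j) := by
  rw [← Finset.sum_erase_add _ _ (Finset.mem_univ i), Function.update_self]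
  congr 1
  exact Finset.sum_congr rfl fun j hj => by
    rw [Function.update_of_ne (Finset.ne_of_mem_erase hj)]

lemma integral_empirical {d : ℕ} (y : Fin N → Euc d) (g : Euc d → ℝ) :
    ∫ u, g u ∂((N : ℝ≥0∞)⁻¹ • ∑ j : Fin N, Measure.dirac (y j)) =
      (N : ℝ)⁻¹ * ∑ j : Fin N, g (y j) := by
  rw [integral_smul_measure, integral_finsetSum_measure fun j _ => integrable_dirac (by simp)]
  simp

end LeaveOneOut

/-- Proposition B.3: leave-one-out Lipschitzness of the first variation
`δ₁U₁` along the λ-tilted Stage-I selection, over empirical measures. -/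
theorem stmt16
    {da dw dx dz : ℕ} (hda : 0 < da) (hdw : 0 < dw) (hdx : 0 < dx) (hdz : 0 < dz)
    (R M ζ1 σ1 : ℝ) (hR : 0 < R) (hM : 0 < M) (hζ1 : 0 < ζ1) (hσ1 : 0 < σ1)
    (lam : ℝ) (hlam : 0 < lam)
    (ρ : Measure (Euc da × Euc dw × ℝ)) (hρ : IsProbabilityMeasure ρ)
    (ΨA : Euc da → Euc dx → ℝ) (ΨW : Euc dw → Euc dz → ℝ)
    (hA1 : A1 ρ M) (hA2 : A2 ΨA ΨW R)
    (til : Measure (Euc dx) → Measure (Euc dz))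
    (htil : IsTiltedSel ρ ΨA ΨW ζ1 σ1 lam til)
    (N : ℕ) (hN : 1 ≤ N)
    (xv : Fin N → Euc dx) (x : Euc dx) (i : Fin N) :
    ∀ x0 : Euc dx,
      |delta1U1 ρ ΨA ΨW ((N : ℝ≥0∞)⁻¹ • ∑ j : Fin N, Measure.dirac (xv j))
          (til ((N : ℝ≥0∞)⁻¹ • ∑ j : Fin N, Measure.dirac (xv j))) x0 -
        delta1U1 ρ ΨA ΨW
          ((N : ℝ≥0∞)⁻¹ • ((∑ j ∈ Finset.univ.erase i, Measure.dirac (xv j)) + Measure.dirac x))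
          (til ((N : ℝ≥0∞)⁻¹ •
            ((∑ j ∈ Finset.univ.erase i, Measure.dirac (xv j)) + Measure.dirac x))) x0| ≤
      (1 / N) * (2 * R ^ 2 + Real.sqrt (2 / σ1) * R ^ 3) := by
  intro x0
  have hN0 : (0 : ℝ) < N := by exact_mod_cast hN
  have : Nonempty (Fin N) := ⟨i⟩
  have hP2 : ∀ y : Fin N → Euc dx,
      IsP2 ((N : ℝ≥0∞)⁻¹ • ∑ j : Fin N, Measure.dirac (y j)) := fun y => by
    simpa using isP2_empirical Finset.univ y Finset.univ_nonempty
  rw [sum_erase_dirac_add]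
  refine (delta1U1_sub_le hR hlam hσ1 hA1 hA2 htil (hP2 _) (hP2 _) (c := 2 * R / N)
    (fun a => ?_) x0).trans (le_of_eq (by ring))
  rw [integral_empirical, integral_empirical, ← mul_sub, ← Finset.sum_sub_distrib,
    Finset.sum_eq_single i (fun j _ hj => by rw [Function.update_of_ne hj, sub_self])
      (fun h => absurd (Finset.mem_univ i) h),
    Function.update_self, abs_mul, abs_of_pos (inv_pos.2 hN0), div_eq_inv_mul]
  refine mul_le_mul_of_nonneg_left ?_ (inv_pos.2 hN0).le
  have h1 := abs_le.1 (hA2.2.2.1 a (xv i))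
  have h2 := abs_le.1 (hA2.2.2.1 a x)
  exact abs_le.2 ⟨by linarith, by linarith⟩
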